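/- Let p ≥ 2 and let E be an edge set on V = {0,…,p−1} such that (i,i) ∈ E for every i and every vertex i admits some j ≠ i with (i,j) ∈ E or (j,i) ∈ E (no isolated nodes). Let Θ be the set of tuples θ = (A, w₂, w₃, w₄) where A is an E-supported Schur stable real p×p matrix, and w₂, w₃, w₄ : V → ℝ are respectively entrywise positive, entrywise nonzero, and entrywise positive; identify θ with the point of ℝ^{|E|+3p} recording the entries (A_{ji})_{(i,j)∈E}, w₂, w₃ and w₄. Then the model is locally identifiable from second-, third- and fourth-order cumulants: there exists a polynomial q in the |E|+3p parameter coordinates, not the zero polynomial, such that for every θ = (A,w₂,w₃,w₄) ∈ Θ with q(θ) ≠ 0, the set {θ′ = (A′,w₂′,w₃′,w₄′) ∈ Θ : T₂(A′,w₂′) = T₂(A,w₂), T₃(A′,w₃′) = T₃(A,w₃), and T₄(A′,w₄′) = T₄(A,w₄)} is finite. -/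

import Mathlib

open Matrix

/-- The order-`n` steady-state cumulant tensor. -/
noncomputable def steadyCumulant (p n : ℕ) (A : Matrix (Fin p) (Fin p) ℝ)
    (w : Fin p → ℝ) (i : Fin n → Fin p) : ℝ :=
  ∑' l : ℕ, ∑ r : Fin p, w r * ∏ m : Fin n, (A ^ l) (i m) r


section helpers
open Finset

section tensors
variable {p n : ℕ} {S S' : Type*} [CommRing S] [CommRing S']

/-- The action of `A` on every slot of the tensor `f`. -/
def Phi (A : Matrix (Fin p) (Fin p) S) (f : (Fin n → Fin p) → S) (i : Fin n → Fin p) : S :=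
  ∑ j : Fin n → Fin p, (∏ m, A (i m) (j m)) * f j

/-- The linearization of `Phi` in `A`, in direction `B`. -/
def Lop (A : Matrix (Fin p) (Fin p) S) (f : (Fin n → Fin p) → S)
    (B : Matrix (Fin p) (Fin p) S) (i : Fin n → Fin p) : S :=
  ∑ j : Fin n → Fin p, (∑ m, (∏ x ∈ univ.erase m, A (i x) (j x)) * B (i m) (j m)) * f j

/-- The diagonal tensor. -/
def Wt (w : Fin p → S) (i : Fin n → Fin p) : S :=
  ∑ r : Fin p, w r * ∏ m, (1 : Matrix (Fin p) (Fin p) S) (i m) r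

lemma Phi_map (φ : S →+* S') (A : Matrix (Fin p) (Fin p) S) (f : (Fin n → Fin p) → S)
    (i : Fin n → Fin p) : φ (Phi A f i) = Phi (A.map φ) (fun j => φ (f j)) i := by
  simp [Phi, map_sum, map_prod]

lemma Lop_map (φ : S →+* S') (A B : Matrix (Fin p) (Fin p) S) (f : (Fin n → Fin p) → S)
    (i : Fin n → Fin p) : φ (Lop A f B i) = Lop (A.map φ) (fun j => φ (f j)) (B.map φ) i := by
  simp [Lop, map_sum, map_prod]

lemma Wt_map (φ : S →+* S') (w : Fin p → S) (i : Fin n → Fin p) :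
    φ (Wt w i) = Wt (fun r => φ (w r)) i := by
  simp [Wt, map_sum, map_prod, Matrix.one_apply, apply_ite φ]

lemma Lop_smul (A B : Matrix (Fin p) (Fin p) S) (f : (Fin n → Fin p) → S)
    (c : S) (i : Fin n → Fin p) : Lop A f (c • B) i = c * Lop A f B i := by
  simp only [Lop, Matrix.smul_apply, smul_eq_mul, Finset.mul_sum, Finset.sum_mul]
  refine sum_congr rfl fun j _ => sum_congr rfl fun m _ => ?_
  ring

lemma Lop_sum {ι : Type*} (s : Finset ι) (A : Matrix (Fin p) (Fin p) S)
    (B : ι → Matrix (Fin p) (Fin p) S) (f : (Fin n → Fin p) → S)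
    (i : Fin n → Fin p) : Lop A f (∑ k ∈ s, B k) i = ∑ k ∈ s, Lop A f (B k) i := by
  simp only [Lop, Matrix.sum_apply, Finset.mul_sum, Finset.sum_mul]
  rw [Finset.sum_comm]
  conv_rhs => rw [Finset.sum_comm' (t' := univ) (s' := fun _ => s) (by simp)]
  rw [Finset.sum_comm]
  refine sum_congr rfl fun j _ => ?_
  rw [Finset.sum_comm]

lemma Lop_single (A B : Matrix (Fin p) (Fin p) S) (f : (Fin n → Fin p) → S)
    (i : Fin n → Fin p) :
    Lop A f B i = ∑ e : Fin p × Fin p, Lop A f (Matrix.single e.1 e.2 1) i * B e.1 e.2 := by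
  conv_lhs => rw [Matrix.matrix_eq_sum_single B]
  rw [Lop_sum, Fintype.sum_prod_type]
  refine sum_congr rfl fun a _ => ?_
  rw [Lop_sum]
  refine sum_congr rfl fun b _ => ?_
  rw [mul_comm, ← Lop_smul]
  simp

lemma deriv_prod {R : Type*} [CommRing R] [Algebra R S]
    (d : Derivation R S S) {ι : Type*} [DecidableEq ι] (s : Finset ι) (f : ι → S) :
    d (∏ m ∈ s, f m) = ∑ m ∈ s, (∏ x ∈ s.erase m, f x) * d (f m) := by
  induction s using Finset.induction_on with
  | empty => simp
  | insert a s ha ih =>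
    rw [prod_insert ha, d.leibniz, ih, sum_insert ha, erase_insert ha]
    simp only [smul_eq_mul, mul_sum]
    rw [add_comm]
    congr 1
    refine sum_congr rfl fun m hm => ?_
    have : a ≠ m := fun h => ha (h ▸ hm)
    rw [erase_insert_of_ne this, prod_insert (by simp [ha]), mul_assoc]

lemma deriv_Phi {R : Type*} [CommRing R] [Algebra R S]
    (d : Derivation R S S) (A : Matrix (Fin p) (Fin p) S) (f : (Fin n → Fin p) → S)
    (i : Fin n → Fin p) :
    d (Phi A f i) = Phi A (fun j => d (f j)) i + Lop A f (A.map d) i := by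
  simp only [Phi, Lop, map_sum, d.leibniz, deriv_prod, smul_eq_mul, sum_add_distrib,
    Matrix.map_apply]
  congr 1
  exact sum_congr rfl fun j _ => mul_comm _ _

lemma deriv_Lop {R : Type*} [CommRing R] [Algebra R S]
    (d : Derivation R S S) (A B : Matrix (Fin p) (Fin p) S) (f : (Fin n → Fin p) → S)
    (i : Fin n → Fin p) :
    d (Lop A f B i) = 
      ∑ j : Fin n → Fin p, (∑ m, (∑ y ∈ univ.erase m,
        (∏ x ∈ (univ.erase m).erase y, A (i x) (j x)) * d (A (i y) (j y))) * B (i m) (j m)) * f j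
      + Lop A f (B.map d) i + Lop A (fun j => d (f j)) B i := by
  simp only [Lop, map_sum, ← sum_add_distrib]
  refine sum_congr rfl fun j _ => ?_
  rw [d.leibniz, map_sum, smul_eq_mul, smul_eq_mul, ← add_mul, ← sum_add_distrib, mul_comm (f j),
    add_comm]
  congr 2
  refine sum_congr rfl fun m _ => ?_
  rw [d.leibniz, deriv_prod, smul_eq_mul, smul_eq_mul, Matrix.map_apply]
  ring

lemma pinned_sum (m : Fin n) (i : Fin n → Fin p) (g : Fin n → S) (h : Fin p → S)
    (f : (Fin n → Fin p) → S) :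
    ∑ j : Fin n → Fin p,
      (∏ x ∈ univ.erase m, g x * (1 : Matrix (Fin p) (Fin p) S) (i x) (j x)) * h (j m) * f j =
    (∏ x ∈ univ.erase m, g x) * ∑ r, h r * f (Function.update i m r) := by
  rw [mul_sum]
  symm
  refine Fintype.sum_of_injective (fun r => Function.update i m r)
    (Function.update_injective i m) _ _ ?_ ?_
  · intro j hj
    have : ∃ x, x ≠ m ∧ i x ≠ j x := by
      by_contra hcon
      push Not at hcon
      refine hj ⟨j m, ?_⟩
      ext x
      by_cases hx : x = m
      · subst hx; simp
      · simp [Function.update_of_ne hx, hcon x hx]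
    obtain ⟨x, hx, hne⟩ := this
    rw [prod_eq_zero (i := x) (by simp [hx]) (by simp [hne])]
    simp
  · intro r
    have : ∏ x ∈ univ.erase m, g x * (1 : Matrix (Fin p) (Fin p) S) (i x)
        (Function.update i m r x) = ∏ x ∈ univ.erase m, g x := by
      refine prod_congr rfl fun x hx => ?_
      rw [Function.update_of_ne (by simpa using hx)]
      simp
    rw [this]
    simp [mul_assoc]

lemma Lop_scalar (a : S) (B : Matrix (Fin p) (Fin p) S) (f : (Fin n → Fin p) → S)
    (i : Fin n → Fin p) :
    Lop (a • 1) f B i = a ^ (n - 1) * ∑ m, ∑ r, B (i m) r * f (Function.update i m r) := by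
  simp only [Lop, sum_mul, Matrix.smul_apply, smul_eq_mul]
  rw [sum_comm, mul_sum]
  refine sum_congr rfl fun m _ => ?_
  have := pinned_sum m i (fun _ => a) (fun r => B (i m) r) f
  simpa [prod_const] using this

lemma Phi_scalar (a : S) (f : (Fin n → Fin p) → S) (i : Fin n → Fin p) :
    Phi (a • 1) f i = a ^ n * f i := by
  rw [Phi, Fintype.sum_eq_single i]
  · simp [prod_const]
  · intro j hj
    obtain ⟨x, hx⟩ := Function.ne_iff.mp hj
    rw [prod_eq_zero (i := x) (by simp) (by simp [hx.symm])]
    simp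

/-- second order term, for a diagonal direction -/
lemma second_term (a : S) (N : Matrix (Fin p) (Fin p) S) (β : Fin p → S)
    (f : (Fin n → Fin p) → S) (i : Fin n → Fin p) :
    ∑ j : Fin n → Fin p, (∑ m, (∑ y ∈ univ.erase m,
      (∏ x ∈ (univ.erase m).erase y, (a • (1 : Matrix (Fin p) (Fin p) S)) (i x) (j x)) *
        N (i y) (j y)) * (Matrix.diagonal β) (i m) (j m)) * f j =
    a ^ (n - 2) * ∑ y, (∑ m ∈ univ.erase y, β (i m)) * 
      ∑ r, N (i y) r * f (Function.update i y r) := by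
  have key : ∀ y : Fin n, ∀ m ∈ univ.erase y, ∑ j : Fin n → Fin p,
      (∏ x ∈ (univ.erase m).erase y, (a • (1 : Matrix (Fin p) (Fin p) S)) (i x) (j x)) *
        N (i y) (j y) * (Matrix.diagonal β) (i m) (j m) * f j =
      a ^ (n - 2) * (β (i m) * ∑ r, N (i y) r * f (Function.update i y r)) := by
    intro y m hm
    have := pinned_sum y i (fun x => if x = m then β (i m) else a) (fun r => N (i y) r) f
    have h1 : ∀ F : Fin n → S, ∏ x ∈ univ.erase y, F x = F m * ∏ x ∈ (univ.erase m).erase y, F x := by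
      intro F
      rw [← mul_prod_erase _ _ hm, erase_right_comm]
    have hc : ((univ.erase m).erase y : Finset (Fin n)).card = n - 2 := by
      rw [card_erase_of_mem, card_erase_of_mem (mem_univ _)]
      · simp; omega
      · simp only [mem_erase, mem_univ, and_true] at hm ⊢; exact hm.symm
    have h2 : ∏ x ∈ (univ.erase m).erase y, (if x = m then β (i m) else a) = a ^ (n - 2) := by
      rw [← hc, ← prod_const]
      refine prod_congr rfl fun x hx => ?_
      simp only [mem_erase] at hx
      rw [if_neg hx.2.1]
    rw [h1 (fun x => if x = m then β (i m) else a), h2] at this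
    simp only [if_true] at this
    rw [show a ^ (n - 2) * (β (i m) * ∑ r, N (i y) r * f (Function.update i y r)) =
      β (i m) * a ^ (n - 2) * ∑ r, N (i y) r * f (Function.update i y r) by ring, ← this]
    refine sum_congr rfl fun j _ => ?_
    rw [h1]
    simp only [if_true]
    have h3 : ∏ x ∈ (univ.erase m).erase y, (if x = m then β (i m) else a) *
        (1 : Matrix (Fin p) (Fin p) S) (i x) (j x) =
        ∏ x ∈ (univ.erase m).erase y, (a • (1 : Matrix (Fin p) (Fin p) S)) (i x) (j x) := by
      refine prod_congr rfl fun x hx => ?_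
      simp only [mem_erase] at hx
      rw [if_neg hx.2.1]; simp
    rw [h3]
    have h4 : (Matrix.diagonal β) (i m) (j m) = β (i m) * (1 : Matrix (Fin p) (Fin p) S) (i m) (j m) := by
      simp [Matrix.diagonal_apply, Matrix.one_apply]
    rw [h4]; ring
  simp only [sum_mul]
  rw [sum_comm, sum_congr rfl (fun m _ => sum_comm),
    sum_comm' (t' := univ) (s' := fun y => univ.erase y) (by simp [eq_comm]), mul_sum]
  refine sum_congr rfl fun y _ => ?_
  rw [sum_congr rfl (key y), ← mul_sum]

end tensors

section core
variable {p n : ℕ}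

/-- the multi-index `(i, …, i, j)` -/
def ix (p n : ℕ) (i j : Fin p) : Fin n → Fin p := fun m => if m.val + 1 = n then j else i

lemma Wt_one_ne {S : Type*} [CommRing S] (w : Fin p → S) (f : Fin n → Fin p) (x y : Fin n)
    (h : f x ≠ f y) : Wt w f = 0 := by
  refine sum_eq_zero fun r _ => ?_
  by_cases hx : f x = r
  · have : f y ≠ r := fun h' => h (hx.trans h'.symm)
    rw [prod_eq_zero (i := y) (by simp) (by simp [this])]; simp
  · rw [prod_eq_zero (i := x) (by simp) (by simp [hx])]; simp

lemma Wt_one_const {S : Type*} [CommRing S] (hn : 0 < n) (w : Fin p → S) (f : Fin n → Fin p)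
    (r : Fin p) (h : ∀ x, f x = r) : Wt w f = w r := by
  rw [Wt, Fintype.sum_eq_single r]
  · have : ∀ x, (1 : Matrix (Fin p) (Fin p) S) (f x) r = 1 := by
      intro x; rw [h x, Matrix.one_apply_eq]
    simp only [this, prod_const_one, mul_one]
  · intro r' hr'
    rw [prod_eq_zero (i := (⟨0, hn⟩ : Fin n)) (by simp) (by rw [h, Matrix.one_apply_ne hr'.symm])]; simp

lemma row_last (hn : 2 ≤ n) (M : Matrix (Fin p) (Fin p) ℝ) (i j : Fin p) (y : Fin n)
    (hy : y.val + 1 = n) :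
    ∑ r, M (ix p n i j y) r * Wt (fun _ => (1 : ℝ)) (Function.update (ix p n i j) y r) = M j i := by
  have h0 : (⟨0, by omega⟩ : Fin n) ≠ y := by intro h; rw [← h] at hy; simp at hy; omega
  rw [Fintype.sum_eq_single i]
  · rw [Wt_one_const (by omega) _ _ i]
    · simp [ix, hy]
    · intro x
      by_cases hx : x = y
      · subst hx; simp
      · rw [Function.update_of_ne hx]
        have : x.val + 1 ≠ n := fun h => hx (Fin.ext (by omega))
        simp [ix, this]
  · intro r hr
    rw [Wt_one_ne _ _ y ⟨0, by omega⟩]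
    · simp
    · rw [Function.update_of_ne h0]
      have : ¬ (0 + 1 = n) := by omega
      simp only [Function.update_self, ix, this, if_false]
      exact hr

lemma row_other (hn : 3 ≤ n) (M : Matrix (Fin p) (Fin p) ℝ) (i j : Fin p) (hij : i ≠ j)
    (y : Fin n) (hy : y.val + 1 ≠ n) :
    ∑ r, M (ix p n i j y) r * Wt (fun _ => (1 : ℝ)) (Function.update (ix p n i j) y r) = 0 := by
  refine sum_eq_zero fun r _ => ?_
  obtain ⟨z, hz, hz'⟩ : ∃ z : Fin n, z ≠ y ∧ z.val + 1 ≠ n := by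
    by_cases h : y.val = 0
    · refine ⟨⟨1, by omega⟩, fun h' => ?_, by simp; omega⟩
      rw [← h'] at h; simp at h
    · refine ⟨⟨0, by omega⟩, fun h' => ?_, by simp; omega⟩
      rw [← h'] at h; simp at h
  rw [Wt_one_ne _ _ z ⟨n - 1, by omega⟩]
  · simp
  · rw [Function.update_of_ne hz, Function.update_of_ne (fun h => hy (by rw [← h]; simp; omega))]
    simp only [ix, hz', if_false]
    rw [if_pos (by omega)]
    exact hij

lemma row_two (M : Matrix (Fin p) (Fin p) ℝ) (i j : Fin p) :
    ∑ r, M (ix p 2 i j 0) r * Wt (fun _ => (1 : ℝ)) (Function.update (ix p 2 i j) 0 r) = M i j := by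
  rw [Fintype.sum_eq_single j]
  · rw [Wt_one_const (by omega) _ _ j]
    · simp [ix]
    · intro x
      fin_cases x <;> simp [ix]
  · intro r hr
    rw [Wt_one_ne _ _ 0 1]
    · simp
    · simpa [ix] using hr

lemma rowsum (k : Fin 3) (M : Matrix (Fin p) (Fin p) ℝ) (s : Fin (k.val + 2) → ℝ) (i j : Fin p)
    (hij : i ≠ j) :
    ∑ y, s y * ∑ r, M (ix p (k.val + 2) i j y) r *
      Wt (fun _ => (1 : ℝ)) (Function.update (ix p (k.val + 2) i j) y r) =
    s (Fin.last _) * M j i + if k = 0 then s 0 * M i j else 0 := by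
  by_cases hk : k = 0
  · subst hk
    have e1 := row_last (n := 2) le_rfl M i j 1 rfl
    have e0 := row_two M i j
    rw [if_pos rfl]
    change ∑ y : Fin 2, _ = s (1 : Fin 2) * M j i + s (0 : Fin 2) * M i j
    rw [Fin.sum_univ_two, ← e1, ← e0, add_comm]
    rfl
  · have hk' : 1 ≤ k.val := by
      rcases Nat.eq_zero_or_pos k.val with h | h
      · exact absurd (Fin.ext h) hk
      · exact h
    rw [if_neg hk, add_zero, Fintype.sum_eq_single (Fin.last _)]
    · rw [row_last (by omega) M i j _ (by simp)]
    · intro y hy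
      rw [row_other (by omega) M i j hij y, mul_zero]
      intro h
      exact hy (Fin.ext (by simp; omega))

lemma ix_last (n : ℕ) (i j : Fin p) : ix p (n + 1) i j (Fin.last _) = j := by simp [ix]

lemma sum_ix (n : ℕ) (β : Fin p → ℝ) (i j : Fin p) :
    ∑ m, β (ix p (n + 1) i j m) = n * β i + β j := by
  rw [Fin.sum_univ_castSucc, ix_last]
  congr 1
  have : ∀ m : Fin n, ix p (n + 1) i j m.castSucc = i := by
    intro m; simp [ix, m.2.ne]
  simp [this]

lemma sum_ix_erase (n : ℕ) (β : Fin p → ℝ) (i j : Fin p) :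
    ∑ m ∈ univ.erase (Fin.last n), β (ix p (n + 1) i j m) = n * β i := by
  have h := add_sum_erase univ (fun m => β (ix p (n + 1) i j m)) (mem_univ (Fin.last n))
  rw [sum_ix, ix_last] at h
  linarith

open PowerSeries in
lemma core_const (N : Matrix (Fin p) (Fin p) ℝ) 
    (hN1 : ∀ i j, N i j = 0 ∨ N j i = 0)
    (hN2 : ∀ i, ∃ j, N i j ≠ 0 ∨ N j i ≠ 0)
    (A : Matrix (Fin p) (Fin p) ℝ⟦X⟧)
    (hA : ∀ i j, A i j = C ((2⁻¹ : ℝ) * (1 : Matrix (Fin p) (Fin p) ℝ) i j) + X * C (N i j))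
    (T : (k : Fin 3) → (Fin (k.val + 2) → Fin p) → ℝ⟦X⟧)
    (hT : ∀ k i, T k i = Wt (fun _ => C (1 - (2⁻¹ : ℝ) ^ (k.val + 2))) i + Phi A (T k) i)
    (B : Matrix (Fin p) (Fin p) ℝ⟦X⟧)
    (hB : ∀ k i j, i ≠ j → Lop A (T k) B (ix p _ i j) = 0) (i j : Fin p) :
    constantCoeff (B i j) = 0 := by
  set c : ℝ⟦X⟧ →+* ℝ := constantCoeff with hc
  set d := PowerSeries.derivative ℝ with hd
  have hA0 : A.map c = (2⁻¹ : ℝ) • 1 := by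
    ext i j; simp [hA, hc]
  have hA1 : A.map (fun x => c (d x)) = N := by
    ext i j; simp [hA, hc, hd]
  -- order zero and one of `T`
  have hW0 : ∀ k : Fin 3, ∀ i : Fin (k.val + 2) → Fin p,
      c (Wt (fun _ => C (1 - (2⁻¹ : ℝ) ^ (k.val + 2))) i)
        = (1 - (2⁻¹ : ℝ) ^ (k.val + 2)) * Wt (fun _ => (1 : ℝ)) i := by
    intro k i
    rw [Wt_map]
    simp [Wt, hc, mul_sum]
  have hpow : ∀ k : Fin 3, (2⁻¹ : ℝ) ^ (k.val + 2) < 1 := fun k =>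
    pow_lt_one₀ (by norm_num) (by norm_num) (by omega)
  have hT0 : ∀ k i, c (T k i) = Wt (fun _ => (1 : ℝ)) i := by
    intro k i
    have h := congrArg c (hT k i)
    rw [map_add, hW0, Phi_map, hA0, Phi_scalar] at h
    have := hpow k
    have h2 : (1 - (2⁻¹ : ℝ) ^ (k.val + 2)) * (c (T k i) - Wt (fun _ => (1 : ℝ)) i) = 0 := by
      linarith
    rcases mul_eq_zero.mp h2 with h3 | h3 <;> linarith
  have hT1 : ∀ k i, (1 - (2⁻¹ : ℝ) ^ (k.val + 2)) * c (d (T k i)) = 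
      (2⁻¹ : ℝ) ^ (k.val + 1) * ∑ m, ∑ r, N (i m) r * 
        Wt (fun _ => (1 : ℝ)) (Function.update i m r) := by
    intro k i
    have h := congrArg (fun x => c (d x)) (hT k i)
    simp only [map_add, deriv_Phi] at h
    have hdW : d (Wt (fun _ => C (1 - (2⁻¹ : ℝ) ^ (k.val + 2))) i) = 0 := by
      have : Wt (fun _ => C (1 - (2⁻¹ : ℝ) ^ (k.val + 2))) i = 
        C (Wt (fun _ => (1 - (2⁻¹ : ℝ) ^ (k.val + 2))) i) := by rw [Wt_map]
      rw [this, hd, derivative_C]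
    rw [hdW, Phi_map, Lop_map, Matrix.map_map, hA0, Phi_scalar, Lop_scalar] at h
    have hA1' : A.map (c ∘ d) = N := hA1
    rw [hA1', show k.val + 2 - 1 = k.val + 1 by omega] at h
    simp only [hT0, map_zero] at h
    linarith
  -- order zero of `B`
  have hB0 : ∀ (k : Fin 3) (i j : Fin p), i ≠ j → ∑ m, ∑ r, c (B (ix p (k.val+2) i j m) r) * 
        Wt (fun _ => (1 : ℝ)) (Function.update (ix p (k.val+2) i j) m r) = 0 := by
    intro k i j hij
    have h := congrArg c (hB k i j hij)
    rw [Lop_map, hA0, Lop_scalar, map_zero] at h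
    simp only [hT0, Matrix.map_apply] at h
    exact (mul_eq_zero.mp h).resolve_left (by positivity)
  have hoff : ∀ i j, i ≠ j → c (B j i) = 0 := by
    intro i j hij
    have h := hB0 1 i j hij
    have e := rowsum 1 (B.map c) (fun _ => 1) i j hij
    simp only [one_mul, Matrix.map_apply] at e
    rw [h] at e
    simpa using e.symm
  set β : Fin p → ℝ := fun i => c (B i i) with hβ
  have hdiag : B.map c = Matrix.diagonal β := by
    ext i j
    by_cases hij : i = j
    · subst hij; simp [hβ]
    · simp [hij, hoff j i (Ne.symm hij)]
  set γ : Matrix (Fin p) (Fin p) ℝ := B.map (fun x => c (d x)) with hγ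
  -- order one
  have hord1 : ∀ (k : Fin 3) (i j : Fin p), i ≠ j → 
      (2⁻¹ : ℝ) ^ (k.val) * ∑ y, (∑ m ∈ univ.erase y, β (ix p (k.val+2) i j m)) * 
        (∑ r, N (ix p (k.val+2) i j y) r * 
          Wt (fun _ => (1 : ℝ)) (Function.update (ix p (k.val+2) i j) y r))
      + (2⁻¹ : ℝ) ^ (k.val + 1) * (∑ m, ∑ r, γ (ix p (k.val+2) i j m) r * 
        Wt (fun _ => (1 : ℝ)) (Function.update (ix p (k.val+2) i j) m r)) 
      + (2⁻¹ : ℝ) ^ (k.val + 1) * ((∑ m, β (ix p (k.val+2) i j m)) * 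
          c (d (T k (ix p (k.val+2) i j)))) = 0 := by
    intro k i j hij
    set I := ix p (k.val+2) i j with hI
    have h := congrArg (fun x => c (d x)) (hB k i j hij)
    have e1 := second_term (2⁻¹ : ℝ) N β (Wt (fun _ => (1 : ℝ))) I
    have e2 := Lop_scalar (2⁻¹ : ℝ) γ (Wt (fun _ => (1 : ℝ))) I
    have e3 := Lop_scalar (2⁻¹ : ℝ) (Matrix.diagonal β) (fun i => c (d (T k i))) I
    rw [show k.val + 2 - 2 = k.val by omega] at e1
    rw [show k.val + 2 - 1 = k.val + 1 by omega] at e2 e3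
    have e4 : ∑ m, ∑ r, Matrix.diagonal β (I m) r * c (d (T k (Function.update I m r))) =
      (∑ m, β (I m)) * c (d (T k I)) := by
      rw [sum_mul]
      refine sum_congr rfl fun m _ => ?_
      rw [Fintype.sum_eq_single (I m)]
      · simp
      · intro r hr
        simp [hr.symm]
    rw [e4] at e3
    rw [← e1, ← e2, ← e3]
    simp only [map_zero] at h
    rw [← h]
    rw [deriv_Lop, map_add, map_add, Lop_map, Lop_map]
    have hAc : ∀ a b, c (A a b) = ((2⁻¹ : ℝ) • (1 : Matrix (Fin p) (Fin p) ℝ)) a b := by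
      intro a b; rw [← hA0]; rfl
    have hAd : ∀ a b, c (d (A a b)) = N a b := by
      intro a b; rw [← hA1]; rfl
    have hBc : ∀ a b, c (B a b) = Matrix.diagonal β a b := by
      intro a b; rw [← hdiag]; rfl
    have hBd : ∀ a b, c (d (B a b)) = γ a b := fun a b => rfl
    rw [hA0, Matrix.map_map, show B.map (c ∘ d) = γ from rfl, hdiag]
    simp only [map_sum, map_mul, map_prod, hAc, hAd, hBc, hT0]
    rfl
  have edge : ∀ i j, N j i ≠ 0 → β i = 0 ∧ β j = 0 := by
    intro i j hne
    have hN0 : N i j = 0 := (hN1 i j).resolve_right hne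
    have hij : i ≠ j := by rintro rfl; exact hne hN0
    have hval : ∀ (k : Fin 3) (i j : Fin p), i ≠ j → (k = 0 → N i j = 0) → 
        (2⁻¹ : ℝ) ^ (k.val) * ((k.val + 1 : ℕ) * β i * N j i)
        + (2⁻¹ : ℝ) ^ (k.val + 1) * (γ j i + if k = 0 then γ i j else 0)
        + (2⁻¹ : ℝ) ^ (k.val + 1) * (((k.val + 1 : ℕ) * β i + β j) * 
          ((2⁻¹ : ℝ) ^ (k.val + 1) * N j i / (1 - (2⁻¹ : ℝ) ^ (k.val + 2)))) = 0 := by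
      intro k i j hij hN0
      have h := hord1 k i j hij
      have h1 := hT1 k (ix p _ i j)
      have s1 := rowsum k N (fun _ => 1) i j hij
      have s2 := rowsum k γ (fun _ => 1) i j hij
      simp only [one_mul] at s1 s2
      rw [s1] at h1
      rw [s2, rowsum k N _ i j hij, sum_ix_erase, sum_ix] at h
      have z : ∀ x : ℝ, (if k = 0 then x * N i j else 0) = 0 := by
        intro x; split_ifs with hk
        · rw [hN0 hk, mul_zero]
        · rfl
      have z1 := z 1
      rw [one_mul] at z1
      rw [z1] at h1
      rw [z] at h
      have hp' := hpow k
      have h2 : c (d (T k (ix p (k.val + 2) i j))) = 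
        (2⁻¹ : ℝ) ^ (k.val + 1) * N j i / (1 - (2⁻¹ : ℝ) ^ (k.val + 2)) := by
        rw [eq_div_iff (by linarith), mul_comm, h1]
        simp
      rw [h2] at h
      simpa using h
    have g := hval 1 j i hij.symm (by simp)
    have g0 := hval 0 i j hij (fun _ => hN0)
    have g1 := hval 1 i j hij (by simp)
    have g2 := hval 2 i j hij (by simp)
    rw [hN0] at g
    rw [if_neg (by decide)] at g2
    norm_num at g g0 g1 g2
    rw [g] at g0
    have hi : β i * N j i = 0 := by linarith
    have hj : β j * N j i = 0 := by linarith
    exact ⟨(mul_eq_zero.mp hi).resolve_right hne, (mul_eq_zero.mp hj).resolve_right hne⟩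
  obtain rfl | hij := eq_or_ne i j
  · obtain ⟨j, hj | hj⟩ := hN2 i
    · exact (edge _ _ hj).2
    · exact (edge _ _ hj).1
  · exact hoff j i hij.symm
end core

section core2
variable {p : ℕ}
open PowerSeries

lemma eq_zero_of_X_dvd {ι : Type*} (P : (ι → ℝ⟦X⟧) → Prop)
    (h0 : ∀ f, P f → ∀ k, constantCoeff (f k) = 0)
    (h1 : ∀ f, P (fun k => X * f k) → P f) (f : ι → ℝ⟦X⟧) (hf : P f) : f = 0 := by
  have key : ∀ n : ℕ, ∀ f, P f → ∀ k, coeff n (f k) = 0 := by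
    intro n
    induction n with
    | zero => intro f hf k; simpa using h0 f hf k
    | succ n ih =>
      intro f hf k
      have : ∀ k, ∃ g, f k = X * g := fun k => X_dvd_iff.mpr (h0 f hf k)
      choose g hg using this
      have hfg : f = fun k => X * g k := funext hg
      have := ih g (h1 g (hfg ▸ hf)) k
      rw [hg k, coeff_succ_X_mul, this]
  funext k
  ext n
  simpa using key n f hf k

lemma sum_sq_eq_zero {ι : Type*} [Fintype ι] (f : ι → ℝ⟦X⟧) (h : ∑ k, f k * f k = 0) : f = 0 := by
  refine eq_zero_of_X_dvd (fun f => ∑ k, f k * f k = 0) ?_ ?_ f h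
  · intro f hf k
    have h := congrArg (constantCoeff (R := ℝ)) hf
    simp only [map_sum, map_mul, map_zero] at h
    rw [Finset.sum_eq_zero_iff_of_nonneg (fun i _ => mul_self_nonneg _)] at h
    exact mul_self_eq_zero.mp (h k (mem_univ _))
  · intro f hf
    have : ∑ k, (X * f k) * (X * f k) = X * X * ∑ k, f k * f k := by
      rw [mul_sum]; exact sum_congr rfl fun k _ => by ring
    rw [this] at hf
    exact (mul_eq_zero.mp hf).resolve_left (mul_ne_zero X_ne_zero X_ne_zero)

lemma core_zero (N : Matrix (Fin p) (Fin p) ℝ) 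
    (hN1 : ∀ i j, N i j = 0 ∨ N j i = 0)
    (hN2 : ∀ i, ∃ j, N i j ≠ 0 ∨ N j i ≠ 0)
    (A : Matrix (Fin p) (Fin p) ℝ⟦X⟧)
    (hA : ∀ i j, A i j = C ((2⁻¹ : ℝ) * (1 : Matrix (Fin p) (Fin p) ℝ) i j) + X * C (N i j))
    (T : (k : Fin 3) → (Fin (k.val + 2) → Fin p) → ℝ⟦X⟧)
    (hT : ∀ k i, T k i = Wt (fun _ => C (1 - (2⁻¹ : ℝ) ^ (k.val + 2))) i + Phi A (T k) i)
    (B : Matrix (Fin p) (Fin p) ℝ⟦X⟧)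
    (hB : ∀ k i j, i ≠ j → Lop A (T k) B (ix p _ i j) = 0) : B = 0 := by
  have := eq_zero_of_X_dvd (ι := Fin p × Fin p) 
    (fun f => ∀ k i j, i ≠ j → Lop A (T k) (Matrix.of fun a b => f (a, b)) (ix p _ i j) = 0)
    (fun f hf k => core_const N hN1 hN2 A hA T hT _ hf k.1 k.2) ?_ (fun k => B k.1 k.2) hB
  · ext1 i j
    exact congrFun this (i, j)
  · intro f hf k i j hij
    have h := hf k i j hij
    have e : (Matrix.of fun a b => X * f (a, b)) = (X : ℝ⟦X⟧) • (Matrix.of fun a b => f (a, b)) := by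
      ext1 a b; simp
    rw [e, Lop_smul] at h
    exact (mul_eq_zero.mp h).resolve_left X_ne_zero

/-- Injectivity is transferred back from power series to the generic ring. -/
lemma transfer {R F : Type*} [CommRing R] [Field F] [Algebra R F]
    [FaithfulSMul R F] {ρ κ : Type*} [Fintype ρ] [Fintype κ] [DecidableEq κ]
    (M : Matrix ρ κ R) (φ : R →+* ℝ⟦X⟧)
    (hφ : ∀ v : κ → ℝ⟦X⟧, (M.map φ).mulVec v = 0 → v = 0)
    (v : κ → F) (hv : (M.map (algebraMap R F)).mulVec v = 0) : v = 0 := by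
  have h1 : ((M.map φ).transpose * M.map φ).det ≠ 0 := by
    intro h
    obtain ⟨v, hv, hv0⟩ := Matrix.exists_mulVec_eq_zero_iff.mpr h
    apply hv
    apply hφ
    apply sum_sq_eq_zero
    have := congrArg (fun u => v ⬝ᵥ u) hv0
    rw [← Matrix.mulVec_mulVec] at this
    simp only [dotProduct_zero] at this
    rw [Matrix.dotProduct_mulVec, Matrix.vecMul_transpose] at this
    exact this
  have h2 : (M.transpose * M).det ≠ 0 := by
    intro h
    apply h1
    have := congrArg φ h
    rw [map_zero, RingHom.map_det] at this
    rw [← this]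
    simp [Matrix.map_mul, Matrix.transpose_map]
  have h3 : ((M.map (algebraMap R F)).transpose * M.map (algebraMap R F)).det ≠ 0 := by
    have : (algebraMap R F) (M.transpose * M).det ≠ 0 := by
      rw [Ne, FaithfulSMul.algebraMap_eq_zero_iff]; exact h2
    rw [RingHom.map_det] at this
    simpa [Matrix.map_mul, Matrix.transpose_map] using this
  refine Matrix.eq_zero_of_mulVec_eq_zero h3 ?_
  rw [← Matrix.mulVec_mulVec, hv, Matrix.mulVec_zero]

end core2

section stable
variable {p : ℕ}

section
attribute [local instance] Matrix.linftyOpNormedRing Matrix.linftyOpNormedAlgebra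

lemma stable_bound (hp : 2 ≤ p) (A : Matrix (Fin p) (Fin p) ℝ)
    (hA : ∀ μ ∈ spectrum ℂ (A.map (algebraMap ℝ ℂ)), ‖μ‖ < 1) :
    ∃ r : ℝ, 0 ≤ r ∧ r < 1 ∧ ∀ᶠ l : ℕ in Filter.atTop, ∀ i j, |(A ^ l) i j| ≤ r ^ l := by
  have : Nonempty (Fin p) := ⟨⟨0, by omega⟩⟩
  set M := A.map (algebraMap ℝ ℂ) with hM
  have h1 : spectralRadius ℂ M < (1 : NNReal) :=
    spectrum.spectralRadius_lt_of_forall_lt M (fun k hk => by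
      rw [← NNReal.coe_lt_coe]; simpa using hA k hk)
  obtain ⟨r, hr1, hr2⟩ := ENNReal.lt_iff_exists_nnreal_btwn.mp h1
  have h2 := (spectrum.pow_nnnorm_pow_one_div_tendsto_nhds_spectralRadius M).eventually_lt_const hr1
  refine ⟨r, r.2, by exact_mod_cast hr2, ?_⟩
  filter_upwards [h2, Filter.eventually_gt_atTop 0] with l hl hl0 i j
  have h3 : (‖M ^ l‖₊ : ENNReal) ≤ (r : ENNReal) ^ l := by
    have h4 := ENNReal.rpow_le_rpow hl.le (z := (l : ℝ)) (by positivity)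
    rw [← ENNReal.rpow_mul, one_div, inv_mul_cancel₀ (by positivity), ENNReal.rpow_one,
      ENNReal.rpow_natCast] at h4
    exact h4
  have h5 : ‖M ^ l‖₊ ≤ r ^ l := by exact_mod_cast h3
  have h6 : (M ^ l) i j = ((A ^ l) i j : ℝ) := by
    have : M ^ l = (A ^ l).map (algebraMap ℝ ℂ) := by
      rw [hM]; exact (map_pow (algebraMap ℝ ℂ).mapMatrix A l).symm
    rw [this]; rfl
  have h7 : ‖(M ^ l) i j‖₊ ≤ ‖M ^ l‖₊ := by
    rw [Matrix.linfty_opNNNorm_def]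
    refine le_trans ?_ (Finset.le_sup (mem_univ i))
    exact Finset.single_le_sum (f := fun j => ‖(M ^ l) i j‖₊) (fun _ _ => zero_le) (mem_univ j)
  have h8 : ‖(M ^ l) i j‖ ≤ (r : ℝ) ^ l := by exact_mod_cast h7.trans h5
  rw [h6] at h8
  simpa using h8
end

/-- the kernel matrix of `Phi` -/
def Ker {S : Type*} [CommRing S] (n : ℕ) (A : Matrix (Fin p) (Fin p) S) :
    Matrix (Fin n → Fin p) (Fin n → Fin p) S :=
  Matrix.of fun i j => ∏ m, A (i m) (j m)

lemma Ker_mulVec {S : Type*} [CommRing S] (n : ℕ) (A : Matrix (Fin p) (Fin p) S)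
    (f : (Fin n → Fin p) → S) : (Ker n A).mulVec f = Phi A f := rfl

lemma Ker_mul {S : Type*} [CommRing S] (n : ℕ) (A B : Matrix (Fin p) (Fin p) S) :
    Ker n (A * B) = Ker n A * Ker n B := by
  ext i j
  simp only [Ker, Matrix.of_apply, Matrix.mul_apply, ← prod_mul_distrib]
  rw [prod_univ_sum]
  simp

lemma Ker_one {S : Type*} [CommRing S] (n : ℕ) : 
    Ker n (1 : Matrix (Fin p) (Fin p) S) = 1 := by
  ext i j
  by_cases h : i = j
  · subst h; simp [Ker]
  · obtain ⟨x, hx⟩ := Function.ne_iff.mp h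
    simp only [Ker, Matrix.of_apply, Matrix.one_apply_ne h]
    exact prod_eq_zero (mem_univ x) (by simp [hx])

lemma Ker_pow {S : Type*} [CommRing S] (n : ℕ) (A : Matrix (Fin p) (Fin p) S) (l : ℕ) :
    Ker n (A ^ l) = Ker n A ^ l := by
  induction l with
  | zero => simp [Ker_one]
  | succ l ih => rw [pow_succ, pow_succ, Ker_mul, ih]

lemma Ker_map {S S' : Type*} [CommRing S] [CommRing S'] (φ : S →+* S') (n : ℕ)
    (A : Matrix (Fin p) (Fin p) S) : (Ker n A).map φ = Ker n (A.map φ) := by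
  ext i j; simp [Ker, map_prod]

lemma det_ne_zero_of_stable (hp : 2 ≤ p) (n : ℕ) (hn : 0 < n) (A : Matrix (Fin p) (Fin p) ℝ)
    (hA : ∀ μ ∈ spectrum ℂ (A.map (algebraMap ℝ ℂ)), ‖μ‖ < 1) :
    (1 - Ker n A).det ≠ 0 := by
  intro h
  obtain ⟨v, hv, hv0⟩ := Matrix.exists_mulVec_eq_zero_iff.mpr h
  rw [Matrix.sub_mulVec, Matrix.one_mulVec, sub_eq_zero] at hv0
  have hpow : ∀ l : ℕ, v = Phi (A ^ l) v := by
    intro l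
    rw [← Ker_mulVec, Ker_pow]
    induction l with
    | zero => simp
    | succ l ih => rw [pow_succ, ← Matrix.mulVec_mulVec, ← hv0, ← ih]
  obtain ⟨r, hr0, hr1, hb⟩ := stable_bound hp A hA
  have hent : ∀ i j, Filter.Tendsto (fun l : ℕ => (A ^ l) i j) Filter.atTop (nhds 0) := by
    intro i j
    refine squeeze_zero_norm' ?_ (tendsto_pow_atTop_nhds_zero_of_lt_one hr0 hr1)
    filter_upwards [hb] with l hl
    simpa using hl i j
  apply hv
  funext i
  have h1 : Filter.Tendsto (fun l : ℕ => Phi (A ^ l) v i) Filter.atTop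
      (nhds (∑ j : Fin n → Fin p, (∏ _m : Fin n, (0 : ℝ)) * v j)) :=
    tendsto_finsetSum _ fun j _ => (tendsto_finsetProd _ fun m _ => hent _ _).mul_const _
  have h2 : (fun l : ℕ => Phi (A ^ l) v i) = fun _ => v i := funext fun l => by rw [← hpow l]
  rw [h2] at h1
  have := tendsto_nhds_unique tendsto_const_nhds h1
  rw [this]
  simp [hn.ne']

lemma steady_rec (hp : 2 ≤ p) (n : ℕ) (hn : 0 < n) (A : Matrix (Fin p) (Fin p) ℝ)
    (hA : ∀ μ ∈ spectrum ℂ (A.map (algebraMap ℝ ℂ)), ‖μ‖ < 1) (w : Fin p → ℝ) 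
    (i : Fin n → Fin p) :
    steadyCumulant p n A w i = Wt w i + Phi A (steadyCumulant p n A w) i := by
  obtain ⟨r, hr0, hr1, hb⟩ := stable_bound hp A hA
  have hs1 : ∀ (i : Fin n → Fin p) (s : Fin p), 
      Summable (fun l : ℕ => w s * ∏ m : Fin n, (A ^ l) (i m) s) := by
    intro i s
    refine Summable.mul_left _ ?_
    refine Summable.of_norm_bounded_eventually_nat (summable_geometric_of_lt_one hr0 hr1) ?_
    filter_upwards [hb] with l hl
    rw [norm_prod]
    calc ∏ m : Fin n, ‖(A ^ l) (i m) s‖ ≤ ∏ _m : Fin n, r ^ l :=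
          prod_le_prod (fun _ _ => norm_nonneg _) (fun m _ => by simpa using hl (i m) s)
      _ = (r ^ l) ^ n := by simp
      _ ≤ r ^ l := pow_le_of_le_one (by positivity) (pow_le_one₀ hr0 hr1.le) hn.ne'
  have hs : ∀ i : Fin n → Fin p, 
      Summable (fun l : ℕ => ∑ s : Fin p, w s * ∏ m : Fin n, (A ^ l) (i m) s) :=
    fun i => summable_sum fun s _ => hs1 i s
  have hstep : ∀ l : ℕ, ∑ s : Fin p, w s * ∏ m : Fin n, (A ^ (l + 1)) (i m) s =
      ∑ j : Fin n → Fin p, (∏ m, A (i m) (j m)) * 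
        ∑ s : Fin p, w s * ∏ m : Fin n, (A ^ l) (j m) s := by
    intro l
    have : ∀ s, ∏ m : Fin n, (A ^ (l + 1)) (i m) s = 
        ∑ j : Fin n → Fin p, (∏ m, A (i m) (j m)) * ∏ m, (A ^ l) (j m) s := by
      intro s
      simp only [pow_succ', Matrix.mul_apply, ← prod_mul_distrib]
      rw [prod_univ_sum]
      simp
    simp only [this, mul_sum]
    rw [sum_comm]
    exact sum_congr rfl fun j _ => sum_congr rfl fun s _ => by ring
  unfold steadyCumulant
  rw [(hs i).tsum_eq_zero_add]
  congr 1
  simp only [hstep]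
  rw [Summable.tsum_finsetSum (fun j _ => (hs j).mul_left _)]
  exact sum_congr rfl fun j _ => tsum_mul_left

end stable

section algebraic

lemma alg_lemma {τ R F : Type*} [CommRing R] [Algebra ℝ R] [Field F] [Algebra ℝ F]
    [Algebra R F] [IsScalarTower ℝ R F] [FaithfulSMul R F] [Algebra.EssFiniteType ℝ F]
    (t : τ → R)
    (hder : ∀ d : Derivation ℝ F F, (∀ s, d (algebraMap R F (t s)) = 0) → ∀ z, d z = 0) (y : R) :
    ∃ G : Polynomial (MvPolynomial τ ℝ),
      G.map (MvPolynomial.aeval t : MvPolynomial τ ℝ →ₐ[ℝ] R).toRingHom ≠ 0 ∧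
      (G.map (MvPolynomial.aeval t : MvPolynomial τ ℝ →ₐ[ℝ] R).toRingHom).eval y = 0 := by
  set S : Set F := Set.range (fun s => algebraMap R F (t s)) with hS
  let K := IntermediateField.adjoin ℝ S
  have hzero : ∀ z : F, KaehlerDifferential.D K F z = 0 := by
    intro z
    by_contra hne
    obtain ⟨f, hf⟩ : ∃ f : Module.Dual F (Ω[F⁄K]), f (KaehlerDifferential.D K F z) ≠ 0 := by
      by_contra hcon
      push Not at hcon
      exact hne ((Module.forall_dual_apply_eq_zero_iff F _).mp hcon)
    apply hf
    let d : Derivation K F F := f.compDer (KaehlerDifferential.D K F)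
    have := hder (d.restrictScalars ℝ) (by
      intro s
      have hmem : algebraMap R F (t s) ∈ K := IntermediateField.subset_adjoin ℝ S ⟨s, rfl⟩
      exact d.map_algebraMap (⟨_, hmem⟩ : K)) z
    exact this
  have hsub : Subsingleton (Ω[F⁄K]) := by
    rw [← Submodule.subsingleton_iff F, ← subsingleton_iff_bot_eq_top,
      ← KaehlerDifferential.span_range_derivation, eq_comm, Submodule.span_eq_bot]
    rintro _ ⟨z, rfl⟩
    exact hzero z
  have : Algebra.FormallyUnramified K F := ⟨hsub⟩
  have : Algebra.EssFiniteType K F := Algebra.EssFiniteType.of_comp ℝ K F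
  have hsep : Algebra.IsSeparable K F := Algebra.FormallyUnramified.isSeparable K F
  have halg : IsAlgebraic K (algebraMap R F y) := Algebra.IsAlgebraic.isAlgebraic _
  have halg2 : IsAlgebraic (Algebra.adjoin ℝ S) (algebraMap R F y) := by
    open scoped IntermediateField.algebraAdjoinAdjoin in
    exact (IsFractionRing.isAlgebraic_iff (Algebra.adjoin ℝ S) K F).mpr halg
  obtain ⟨g, hg0, hg⟩ := halg2
  let φ : MvPolynomial τ ℝ →ₐ[ℝ] F := MvPolynomial.aeval (fun s => algebraMap R F (t s))
  have hφ : ∀ a, φ a = algebraMap R F (MvPolynomial.aeval t a) := by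
    intro a
    exact MvPolynomial.aeval_algebraMap_apply F t a
  have hlift : ∀ a : Algebra.adjoin ℝ S, ∃ b, φ b = a := by
    intro a
    have h := Algebra.adjoin_range_eq_range_aeval ℝ (fun s => algebraMap R F (t s))
    have h2 : (a : F) ∈ (MvPolynomial.aeval (R := ℝ) (fun s => algebraMap R F (t s))).range := by
      rw [← h]; exact a.2
    exact h2
  choose l hl using hlift
  have hl0 : ∃ l : Algebra.adjoin ℝ S → MvPolynomial τ ℝ, (∀ a, φ (l a) = a) ∧ l 0 = 0 := by
    classical
    refine ⟨Function.update l 0 0, ?_, by simp⟩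
    intro a
    by_cases ha : a = 0
    · subst ha; simp
    · rw [Function.update_of_ne ha, hl]
  obtain ⟨l, hl, hl0⟩ := hl0
  let G : Polynomial (MvPolynomial τ ℝ) :=
    ∑ m ∈ g.support, Polynomial.monomial m (l (g.coeff m))
  have hG : G.map φ.toRingHom = g.map (algebraMap (Algebra.adjoin ℝ S) F) := by
    conv_rhs => rw [g.as_sum_support]
    simp only [G, Polynomial.map_sum, Polynomial.map_monomial]
    refine sum_congr rfl fun m _ => ?_
    congr 1
    exact hl _
  have hGR : G.map φ.toRingHom = (G.map 
      (MvPolynomial.aeval t : MvPolynomial τ ℝ →ₐ[ℝ] R).toRingHom).map (algebraMap R F) := by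
    rw [Polynomial.map_map]
    congr 1
    exact RingHom.ext fun a => hφ a
  refine ⟨G, ?_, ?_⟩
  · intro h
    rw [hGR, h, Polynomial.map_zero] at hG
    apply hg0
    refine Polynomial.map_injective _ ?_ ((hG.symm).trans (Polynomial.map_zero _).symm)
    exact Subtype.val_injective
  · have h := hg
    rw [Polynomial.aeval_def, ← Polynomial.eval_map, ← hG, hGR, Polynomial.eval_map,
      Polynomial.eval₂_at_apply] at h
    exact (FaithfulSMul.algebraMap_eq_zero_iff R F).mp h

lemma der_loc {P S F : Type*} [CommRing P] [CommRing S] [Field F] [Algebra ℝ F]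
    [Algebra P S] [Algebra S F] (M : Submonoid P) [IsLocalization M S]
    (d : Derivation ℝ F F) (h : ∀ a : P, d (algebraMap S F (algebraMap P S a)) = 0) (s : S) :
    d (algebraMap S F s) = 0 := by
  obtain ⟨⟨a, b⟩, hab⟩ := IsLocalization.surj M s
  have h1 := congrArg (fun z => d (algebraMap S F z)) hab
  simp only [map_mul, d.leibniz, h, smul_eq_mul, mul_zero, zero_add] at h1
  refine (mul_eq_zero.mp h1).resolve_left ?_
  exact ((IsLocalization.map_units S b).map (algebraMap S F)).ne_zero

lemma rec_unique {p n : ℕ} {S : Type*} [CommRing S] (A : Matrix (Fin p) (Fin p) S)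
    (w : Fin p → S) (hdet : IsUnit (1 - Ker n A).det) (f g : (Fin n → Fin p) → S)
    (hf : ∀ i, f i = Wt w i + Phi A f i) (hg : ∀ i, g i = Wt w i + Phi A g i) : f = g := by
  have e : ∀ f : (Fin n → Fin p) → S, (∀ i, f i = Wt w i + Phi A f i) →
      (1 - Ker n A).mulVec f = Wt w := by
    intro f hf
    rw [Matrix.sub_mulVec, Matrix.one_mulVec, Ker_mulVec]
    funext i
    rw [Pi.sub_apply, hf i]; simp
  have hinj := Matrix.mulVec_injective_of_isUnit ((Matrix.isUnit_iff_isUnit_det _).mpr hdet)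
  exact hinj ((e f hf).trans (e g hg).symm)

lemma rec_exists {p n : ℕ} {S : Type*} [CommRing S] (A : Matrix (Fin p) (Fin p) S)
    (w : Fin p → S) (hdet : IsUnit (1 - Ker n A).det) :
    ∃ f : (Fin n → Fin p) → S, ∀ i, f i = Wt w i + Phi A f i := by
  refine ⟨(1 - Ker n A)⁻¹.mulVec (Wt w), fun i => ?_⟩
  set f := (1 - Ker n A)⁻¹.mulVec (Wt w) with hf
  have h : (1 - Ker n A).mulVec f = Wt w := by
    rw [hf, Matrix.mulVec_mulVec, Matrix.mul_nonsing_inv _ hdet, Matrix.one_mulVec]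
  rw [← h, Matrix.sub_mulVec, Matrix.one_mulVec, Ker_mulVec]
  simp

lemma det_map {p n : ℕ} {S S' : Type*} [CommRing S] [CommRing S'] (φ : S →+* S')
    (A : Matrix (Fin p) (Fin p) S) :
    φ (1 - Ker n A).det = (1 - Ker n (A.map φ)).det := by
  rw [RingHom.map_det, map_sub, map_one]
  congr 2
  exact Ker_map φ n A

lemma det_half {p n : ℕ} (hn : 0 < n) :
    (1 - Ker n ((2⁻¹ : ℝ) • (1 : Matrix (Fin p) (Fin p) ℝ))).det ≠ 0 := by
  have h : Ker n ((2⁻¹ : ℝ) • (1 : Matrix (Fin p) (Fin p) ℝ)) = (2⁻¹ : ℝ) ^ n • 1 := by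
    rw [← Ker_one]
    ext i j
    simp [Ker, prod_mul_distrib]
  have h2 : (1 - Ker n ((2⁻¹ : ℝ) • (1 : Matrix (Fin p) (Fin p) ℝ))) = 
      (1 - (2⁻¹ : ℝ) ^ n) • 1 := by
    rw [h, sub_smul, one_smul]
  rw [h2, Matrix.det_smul, Matrix.det_one, mul_one]
  apply pow_ne_zero
  have : (2⁻¹ : ℝ) ^ n < 1 := pow_lt_one₀ (by norm_num) (by norm_num) hn.ne'
  linarith

end algebraic

section generic
variable {p : ℕ}

/-- parameter coordinates -/
abbrev Sig (E : Finset (Fin p × Fin p)) : Type :=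
  {e : Fin p × Fin p // e ∈ E} ⊕ (Fin 3 × Fin p)

/-- the generic `E`-supported matrix -/
noncomputable def AP (E : Finset (Fin p × Fin p)) :
    Matrix (Fin p) (Fin p) (MvPolynomial (Sig E) ℝ) :=
  fun j i => if h : (i, j) ∈ E then MvPolynomial.X (Sum.inl ⟨(i, j), h⟩) else 0

/-- the generic weights -/
noncomputable def wP (E : Finset (Fin p × Fin p)) (k : Fin 3) (r : Fin p) :
    MvPolynomial (Sig E) ℝ := MvPolynomial.X (Sum.inr (k, r))

/-- the product of the determinants of the cumulant recursions -/
noncomputable def Dl (E : Finset (Fin p × Fin p)) : MvPolynomial (Sig E) ℝ :=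
  ∏ k : Fin 3, (1 - Ker (k.val + 2) (AP E)).det

lemma Dl_map {S : Type*} [CommRing S] (E : Finset (Fin p × Fin p))
    (φ : MvPolynomial (Sig E) ℝ →+* S) :
    φ (Dl E) = ∏ k : Fin 3, (1 - Ker (k.val + 2) ((AP E).map φ)).det := by
  rw [Dl, map_prod]
  exact prod_congr rfl fun k _ => det_map φ _

open PowerSeries in
/-- specialization to a curve through a scalar matrix -/
noncomputable def phi0 (E : Finset (Fin p × Fin p)) (N : Matrix (Fin p) (Fin p) ℝ) :
    MvPolynomial (Sig E) ℝ →+* ℝ⟦X⟧ :=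
  MvPolynomial.eval₂Hom (C : ℝ →+* ℝ⟦X⟧) (Sum.elim
    (fun e => C ((2⁻¹ : ℝ) * (1 : Matrix (Fin p) (Fin p) ℝ) e.1.2 e.1.1) + X * C (N e.1.2 e.1.1))
    (fun kr => C (1 - (2⁻¹ : ℝ) ^ (kr.1.val + 2))))

open PowerSeries in
lemma phi0_AP (E : Finset (Fin p × Fin p)) (hself : ∀ i : Fin p, (i, i) ∈ E)
    (N : Matrix (Fin p) (Fin p) ℝ) (hN : ∀ i j, (i, j) ∉ E → N j i = 0) (i j : Fin p) :
    (AP E).map (phi0 E N) i j =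
      C ((2⁻¹ : ℝ) * (1 : Matrix (Fin p) (Fin p) ℝ) i j) + X * C (N i j) := by
  rw [Matrix.map_apply, AP]
  split_ifs with h
  · simp [phi0]
  · have hij : i ≠ j := fun e => h (e ▸ hself _)
    simp [hN _ _ h, hij]

open PowerSeries in
lemma phi0_wP (E : Finset (Fin p × Fin p)) (N : Matrix (Fin p) (Fin p) ℝ) (k : Fin 3) (r : Fin p) :
    phi0 E N (wP E k r) = C (1 - (2⁻¹ : ℝ) ^ (k.val + 2)) := by
  rw [wP, phi0, MvPolynomial.coe_eval₂Hom, MvPolynomial.eval₂_X]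
  rfl

lemma phi0_Dl (E : Finset (Fin p × Fin p)) (hself : ∀ i : Fin p, (i, i) ∈ E)
    (N : Matrix (Fin p) (Fin p) ℝ) (hN : ∀ i j, (i, j) ∉ E → N j i = 0) :
    IsUnit (phi0 E N (Dl E)) := by
  rw [PowerSeries.isUnit_iff_constantCoeff, ← RingHom.comp_apply, Dl_map, isUnit_iff_ne_zero]
  rw [prod_ne_zero_iff]
  intro k _
  have : (AP E).map ((PowerSeries.constantCoeff (R := ℝ)).comp (phi0 E N)) =
      (2⁻¹ : ℝ) • (1 : Matrix (Fin p) (Fin p) ℝ) := by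
    ext i j
    have h := phi0_AP E hself N hN i j
    rw [Matrix.map_apply] at h
    rw [Matrix.map_apply, RingHom.comp_apply, h]
    simp
  rw [this]
  exact det_half (by omega)

lemma exists_N (E : Finset (Fin p × Fin p))
    (hnoiso : ∀ i : Fin p, ∃ j : Fin p, j ≠ i ∧ ((i, j) ∈ E ∨ (j, i) ∈ E)) :
    ∃ N : Matrix (Fin p) (Fin p) ℝ, (∀ i j, (i, j) ∉ E → N j i = 0) ∧
      (∀ i j, N i j = 0 ∨ N j i = 0) ∧ (∀ i, ∃ j, N i j ≠ 0 ∨ N j i ≠ 0) := by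
  refine ⟨fun j i => if (i, j) ∈ E ∧ i ≠ j ∧ ((j, i) ∉ E ∨ i < j) then 1 else 0, ?_, ?_, ?_⟩
  · intro i j h
    simp [h]
  · intro i j
    by_cases h : (j, i) ∈ E ∧ j ≠ i ∧ ((i, j) ∉ E ∨ j < i)
    · right
      beta_reduce
      rw [if_neg]
      rintro ⟨h1, h2, h3⟩
      obtain ⟨h4, h5, h6⟩ := h
      rcases h3 with h3 | h3
      · exact h3 h4
      · rcases h6 with h6 | h6
        · exact h6 h1
        · exact lt_asymm h3 h6
    · left
      beta_reduce
      rw [if_neg h]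
  · intro i
    obtain ⟨j, hj, h⟩ := hnoiso i
    refine ⟨j, ?_⟩
    simp only [ne_eq, ite_eq_right_iff, one_ne_zero, imp_false, not_not]
    rcases lt_or_gt_of_ne hj with hlt | hlt
    · by_cases h1 : (j, i) ∈ E
      · exact Or.inl ⟨h1, hj, Or.inr hlt⟩
      · exact Or.inr ⟨h.resolve_right h1, hj.symm, Or.inl h1⟩
    · by_cases h1 : (i, j) ∈ E
      · exact Or.inr ⟨h1, hj.symm, Or.inr hlt⟩
      · exact Or.inl ⟨h.resolve_left h1, hj, Or.inl h1⟩

lemma ix_ne (n : ℕ) (i j : Fin p) (hij : i ≠ j) :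
    ix p (n + 2) i j 0 ≠ ix p (n + 2) i j (Fin.last _) := by
  simpa [ix] using hij

/-- the matrix of the linearized recursions -/
def MM {R : Type*} [CommRing R] (A : Matrix (Fin p) (Fin p) R)
    (T : (k : Fin 3) → (Fin (k.val + 2) → Fin p) → R) :
    Matrix (Fin 3 × Fin p × Fin p) (Fin p × Fin p) R :=
  Matrix.of fun ρ e => if ρ.2.1 = ρ.2.2 then 0 else
    Lop A (T ρ.1) (Matrix.single e.1 e.2 1) (ix p _ ρ.2.1 ρ.2.2)

lemma MM_mulVec {R S : Type*} [CommRing R] [CommRing S] (A : Matrix (Fin p) (Fin p) R)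
    (T : (k : Fin 3) → (Fin (k.val + 2) → Fin p) → R) (ψ : R →+* S)
    (B : Matrix (Fin p) (Fin p) S) (k : Fin 3) (i j : Fin p) (hij : i ≠ j) :
    ((MM A T).map ψ).mulVec (fun e => B e.1 e.2) (k, i, j) =
      Lop (A.map ψ) (fun j => ψ (T k j)) B (ix p _ i j) := by
  rw [Lop_single]
  simp only [Matrix.mulVec, dotProduct, Matrix.map_apply, MM, Matrix.of_apply, if_neg hij]
  refine sum_congr rfl fun e _ => ?_
  rw [Lop_map]
  congr 2
  ext x y
  simp [Matrix.single_apply, apply_ite ψ]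

lemma MM_mulVec_diag {R S : Type*} [CommRing R] [CommRing S] (A : Matrix (Fin p) (Fin p) R)
    (T : (k : Fin 3) → (Fin (k.val + 2) → Fin p) → R) (ψ : R →+* S)
    (v : Fin p × Fin p → S) (k : Fin 3) (i : Fin p) :
    ((MM A T).map ψ).mulVec v (k, i, i) = 0 := by
  simp [Matrix.mulVec, dotProduct, MM]

lemma main_der (E : Finset (Fin p × Fin p)) (hself : ∀ i : Fin p, (i, i) ∈ E)
    (hnoiso : ∀ i : Fin p, ∃ j : Fin p, j ≠ i ∧ ((i, j) ∈ E ∨ (j, i) ∈ E))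
    {R F : Type*} [CommRing R] [Algebra (MvPolynomial (Sig E) ℝ) R]
    [IsLocalization.Away (Dl E) R] [Field F] [Algebra R F] [IsFractionRing R F] [IsDomain R]
    [Algebra ℝ R] [Algebra ℝ F] [IsScalarTower ℝ R F]
    [IsScalarTower ℝ (MvPolynomial (Sig E) ℝ) R]
    (T : (k : Fin 3) → (Fin (k.val + 2) → Fin p) → R)
    (hT : ∀ k i, T k i = Wt (fun r => algebraMap _ R (wP E k r)) i +
      Phi ((AP E).map (algebraMap _ R)) (T k) i)
    (d : Derivation ℝ F F) (hd : ∀ k i, d (algebraMap R F (T k i)) = 0) (z : F) : d z = 0 := by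
  obtain ⟨N, hN, hN1, hN2⟩ := exists_N E hnoiso
  set A : Matrix (Fin p) (Fin p) R := (AP E).map (algebraMap _ R) with hA
  set w : Fin 3 → Fin p → R := fun k r => algebraMap _ R (wP E k r) with hw
  let φ : R →+* PowerSeries ℝ := IsLocalization.Away.lift (Dl E) (phi0_Dl E hself N hN)
  have hφ : ∀ a, φ (algebraMap _ R a) = phi0 E N a :=
    fun a => IsLocalization.Away.lift_eq (Dl E) (phi0_Dl E hself N hN) a
  have hφA : ∀ i j, A.map φ i j = PowerSeries.C ((2⁻¹ : ℝ) * (1 : Matrix (Fin p) (Fin p) ℝ) i j) +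
      PowerSeries.X * PowerSeries.C (N i j) := by
    intro i j
    rw [← phi0_AP E hself N hN, hA]
    simp only [Matrix.map_apply]
    exact hφ _
  have hφT : ∀ k i, φ (T k i) = Wt (fun _ => PowerSeries.C (1 - (2⁻¹ : ℝ) ^ (k.val + 2))) i
      + Phi (A.map φ) (fun j => φ (T k j)) i := by
    intro k i
    rw [hT k i, map_add, Wt_map, Phi_map]
    congr 2
    funext r
    rw [hφ, phi0_wP]
  -- the recursion over the fraction field
  have hTF : ∀ k i, algebraMap R F (T k i) = Wt (fun r => algebraMap R F (w k r)) i +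
      Phi (A.map (algebraMap R F)) (fun j => algebraMap R F (T k j)) i := by
    intro k i
    conv_lhs => rw [hT k i]
    rw [map_add, Wt_map, Phi_map]
  have hdrec : ∀ k i, d (Wt (fun r => algebraMap R F (w k r)) i) +
      Lop (A.map (algebraMap R F)) (fun j => algebraMap R F (T k j))
        ((A.map (algebraMap R F)).map d) i = 0 := by
    intro k i
    have h := congrArg d (hTF k i)
    rw [hd, map_add, deriv_Phi] at h
    simp only [hd] at h
    have h0 : Phi (A.map (algebraMap R F)) (fun _ : Fin (k.val + 2) → Fin p => (0 : F)) i = 0 := by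
      simp [Phi]
    rw [h0, zero_add] at h
    exact h.symm
  -- the derivative of the matrix vanishes
  have hdA : ∀ e : Fin p × Fin p, d (algebraMap R F (A e.1 e.2)) = 0 := by
    have key := transfer (F := F) (MM A T) φ (by
      intro v hv
      have hB := core_zero N hN1 hN2 (A.map φ) hφA (fun k j => φ (T k j)) hφT
        (Matrix.of fun x y => v (x, y)) (by
          intro k i j hij
          rw [← MM_mulVec A T φ _ k i j hij]
          exact congrFun hv (k, i, j))
      funext e
      exact congrFun (congrFun hB e.1) e.2)
      (fun e => ((A.map (algebraMap R F)).map d) e.1 e.2) (by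
      funext ⟨k, i, j⟩
      by_cases hij : i = j
      · subst hij
        exact MM_mulVec_diag _ _ _ _ _ _
      · rw [MM_mulVec A T _ _ k i j hij]
        have h := hdrec k (ix p _ i j)
        rw [Wt_one_ne _ _ _ _ (ix_ne k.val i j hij), map_zero, zero_add] at h
        exact h)
    intro e
    exact congrFun key e
  have hdA0 : (A.map (algebraMap R F)).map d = 0 := by
    ext i j
    exact hdA (i, j)
  have hdw : ∀ k r, d (algebraMap R F (w k r)) = 0 := by
    intro k r
    have h := hdrec k (fun _ => r)
    rw [Wt_one_const (by omega) _ _ r (fun _ => rfl), hdA0] at h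
    have h0 : Lop (A.map (algebraMap R F)) (fun j => algebraMap R F (T k j)) 0
        (fun _ => r) = 0 := by
      simp [Lop]
    rw [h0, add_zero] at h
    exact h
  have hX : ∀ x : Sig E,
      d (algebraMap R F (algebraMap _ R (MvPolynomial.X x : MvPolynomial (Sig E) ℝ))) = 0 := by
    rintro (⟨⟨i, j⟩, h⟩ | ⟨k, r⟩)
    · have := hdA (j, i)
      simpa [hA, AP, h] using this
    · exact hdw k r
  have hP : ∀ a : MvPolynomial (Sig E) ℝ, d (algebraMap R F (algebraMap _ R a)) = 0 := by
    intro a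
    induction a using MvPolynomial.induction_on with
    | C c =>
      have : algebraMap R F (algebraMap _ R (MvPolynomial.C c : MvPolynomial (Sig E) ℝ)) =
          algebraMap ℝ F c := by
        rw [IsScalarTower.algebraMap_apply ℝ R F,
          IsScalarTower.algebraMap_apply ℝ (MvPolynomial (Sig E) ℝ) R]
        rfl
      rw [this, d.map_algebraMap]
    | add a b ha hb => rw [map_add, map_add, map_add, ha, hb, add_zero]
    | mul_X a x ha => simp only [map_mul, d.leibniz, ha, hX, smul_eq_mul, mul_zero, add_zero]
  have hR : ∀ a : R, d (algebraMap R F a) = 0 := der_loc (Submonoid.powers (Dl E)) d hP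
  exact der_loc (S := F) (nonZeroDivisors R) d (by simpa using hR) z

end generic

section final
variable {p : ℕ}

/-- the point of parameter space -/
def pt (E : Finset (Fin p × Fin p)) (A : Matrix (Fin p) (Fin p) ℝ) (w : Fin 3 → Fin p → ℝ) :
    Sig E → ℝ :=
  Sum.elim (fun e => A e.1.2 e.1.1) (fun ki => w ki.1 ki.2)

/-- all cumulants of orders two, three and four -/
noncomputable def cum (A : Matrix (Fin p) (Fin p) ℝ) (w : Fin 3 → Fin p → ℝ)
    (s : Σ k : Fin 3, (Fin (k.val + 2) → Fin p)) : ℝ :=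
  steadyCumulant p (s.1.val + 2) A (w s.1) s.2

lemma eval_AP (E : Finset (Fin p × Fin p)) (A : Matrix (Fin p) (Fin p) ℝ)
    (w : Fin 3 → Fin p → ℝ) (hA : ∀ i j : Fin p, (i, j) ∉ E → A j i = 0) :
    (AP E).map (MvPolynomial.eval (pt E A w)) = A := by
  ext j i
  rw [Matrix.map_apply, AP]
  split_ifs with h
  · simp [pt]
  · simp [hA _ _ h]

lemma elim_exists (hp : 2 ≤ p) (E : Finset (Fin p × Fin p)) (hself : ∀ i : Fin p, (i, i) ∈ E)
    (hnoiso : ∀ i : Fin p, ∃ j : Fin p, j ≠ i ∧ ((i, j) ∈ E ∨ (j, i) ∈ E)) (x : Sig E) :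
    ∃ (G : Polynomial (MvPolynomial (Σ k : Fin 3, (Fin (k.val + 2) → Fin p)) ℝ))
      (num : MvPolynomial (Sig E) ℝ), num ≠ 0 ∧
      ∀ (A : Matrix (Fin p) (Fin p) ℝ) (w : Fin 3 → Fin p → ℝ),
        (∀ i j : Fin p, (i, j) ∉ E → A j i = 0) →
        (∀ μ ∈ spectrum ℂ (A.map (algebraMap ℝ ℂ)), ‖μ‖ < 1) →
        (MvPolynomial.eval (pt E A w) num ≠ 0 →
          G.map (MvPolynomial.eval (cum A w)) ≠ 0) ∧
        (G.map (MvPolynomial.eval (cum A w))).eval (pt E A w x) = 0 := by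
  obtain ⟨N, hN, hN1, hN2⟩ := exists_N E hnoiso
  have hDl0 : Dl E ≠ 0 := by
    intro h
    have := phi0_Dl E hself N hN
    rw [h, map_zero] at this
    exact not_isUnit_zero this
  let R := Localization.Away (Dl E)
  let F := FractionRing R
  have hle : Submonoid.powers (Dl E) ≤ nonZeroDivisors (MvPolynomial (Sig E) ℝ) :=
    powers_le_nonZeroDivisors_of_noZeroDivisors hDl0
  have hdom : IsDomain R := IsLocalization.isDomain_localization hle
  have hinjPR : Function.Injective (algebraMap (MvPolynomial (Sig E) ℝ) R) :=
    IsLocalization.injective R hle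
  have hunit : ∀ k : Fin 3,
      IsUnit (1 - Ker (k.val + 2) ((AP E).map (algebraMap _ R))).det := by
    intro k
    have h : IsUnit (algebraMap (MvPolynomial (Sig E) ℝ) R (Dl E)) :=
      IsLocalization.Away.algebraMap_isUnit (Dl E)
    rw [Dl_map] at h
    exact isUnit_of_dvd_unit (dvd_prod_of_mem (fun k : Fin 3 =>
      (1 - Ker (k.val + 2) ((AP E).map (algebraMap _ R))).det) (mem_univ k)) h
  have hTex := fun k : Fin 3 => rec_exists (n := k.val + 2) ((AP E).map (algebraMap _ R))
    (fun r => algebraMap _ R (wP E k r)) (hunit k)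
  choose T hT using hTex
  have : Algebra.EssFiniteType (MvPolynomial (Sig E) ℝ) R :=
    Algebra.EssFiniteType.of_isLocalization R (Submonoid.powers (Dl E))
  have : Algebra.EssFiniteType ℝ R := Algebra.EssFiniteType.comp ℝ (MvPolynomial (Sig E) ℝ) R
  have : Algebra.EssFiniteType R F := Algebra.EssFiniteType.of_isLocalization F (nonZeroDivisors R)
  have : Algebra.EssFiniteType ℝ F := Algebra.EssFiniteType.comp ℝ R F
  obtain ⟨G, hG0, hG⟩ := alg_lemma (F := F)
    (fun s : (Σ k : Fin 3, (Fin (k.val + 2) → Fin p)) => T s.1 s.2)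
    (fun d hd z => main_der E hself hnoiso T hT d (fun k i => hd ⟨k, i⟩) z)
    (algebraMap (MvPolynomial (Sig E) ℝ) R (MvPolynomial.X x))
  set θ := (MvPolynomial.aeval (R := ℝ)
    (fun s : (Σ k : Fin 3, (Fin (k.val + 2) → Fin p)) => T s.1 s.2)).toRingHom with hθ
  obtain ⟨m, hm⟩ : ∃ m, θ (G.coeff m) ≠ 0 := by
    by_contra hcon
    push Not at hcon
    apply hG0
    ext m
    rw [Polynomial.coeff_map, hcon, Polynomial.coeff_zero]
  obtain ⟨⟨num, den⟩, hnum⟩ := IsLocalization.surj (Submonoid.powers (Dl E)) (θ (G.coeff m))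
  dsimp only at hnum
  refine ⟨G, num, ?_, ?_⟩
  · intro h
    rw [h, map_zero] at hnum
    exact (mul_ne_zero hm (IsLocalization.map_units R den).ne_zero) hnum
  · intro A w hA hst
    have hDu : IsUnit (MvPolynomial.eval (pt E A w) (Dl E)) := by
      rw [Dl_map, eval_AP E A w hA, isUnit_iff_ne_zero, prod_ne_zero_iff]
      intro k _
      exact det_ne_zero_of_stable hp _ (by omega) A hst
    let ev : R →+* ℝ := IsLocalization.Away.lift (Dl E) hDu
    have hev : ∀ a, ev (algebraMap _ R a) = MvPolynomial.eval (pt E A w) a :=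
      fun a => IsLocalization.Away.lift_eq (Dl E) hDu a
    have hevA : ((AP E).map (algebraMap _ R)).map ev = A := by
      rw [← eval_AP E A w hA]
      ext i j
      simp only [Matrix.map_apply]
      rw [hev]
    have hevT : ∀ k : Fin 3, (fun i => ev (T k i)) = steadyCumulant p (k.val + 2) A (w k) := by
      intro k
      refine rec_unique A (w k)
        (isUnit_iff_ne_zero.mpr (det_ne_zero_of_stable hp _ (by omega) A hst)) _ _ ?_
        (steady_rec hp _ (by omega) A hst (w k))
      intro i
      beta_reduce
      rw [hT k i, map_add, Wt_map, Phi_map, hevA]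
      congr 2
      funext r
      rw [hev]
      simp [wP, pt]
    have hcomp : ev.comp θ = MvPolynomial.eval (cum A w) := by
      apply MvPolynomial.ringHom_ext
      · intro c
        have : θ (MvPolynomial.C c) =
            algebraMap (MvPolynomial (Sig E) ℝ) R (MvPolynomial.C c) := by
          rw [hθ]
          simp
          rfl
        rw [RingHom.comp_apply, this, hev]
        simp
      · intro s
        have : θ (MvPolynomial.X s) = T s.1 s.2 := by simp [hθ]
        rw [RingHom.comp_apply, this]
        simp only [MvPolynomial.eval_X, cum]
        exact congrFun (hevT s.1) s.2
    constructor
    · intro hne h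
      apply hne
      have h1 := congrArg ev hnum
      rw [map_mul, hev, hev] at h1
      have h2 : ev (θ (G.coeff m)) = 0 := by
        have := congrArg (fun f => Polynomial.coeff f m) h
        simpa [← hcomp] using this
      rw [← h1, h2, zero_mul]
    · rw [← hcomp, ← Polynomial.map_map]
      have h1 := congrArg ev hG
      rw [map_zero, ← Polynomial.eval₂_at_apply, ← Polynomial.eval_map, hev,
        MvPolynomial.eval_X] at h1
      exact h1

end final

end helpers

/-- For a directed graph with all self-loops and no isolated nodes,
the discrete Lyapunov model is generically locally identifiable from second-, third-
and fourth-order cumulants. -/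
theorem stmt_11 (p : ℕ) (hp : 2 ≤ p) (E : Finset (Fin p × Fin p))
    (hself : ∀ i : Fin p, (i, i) ∈ E)
    (hnoiso : ∀ i : Fin p, ∃ j : Fin p, j ≠ i ∧ ((i, j) ∈ E ∨ (j, i) ∈ E)) :
    ∃ q : MvPolynomial ({e : Fin p × Fin p // e ∈ E} ⊕ (Fin 3 × Fin p)) ℝ,
      q ≠ 0 ∧
      ∀ (A : Matrix (Fin p) (Fin p) ℝ) (w₂ w₃ w₄ : Fin p → ℝ),
        (∀ i j : Fin p, (i, j) ∉ E → A j i = 0) →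
        (∀ μ ∈ spectrum ℂ (A.map (algebraMap ℝ ℂ)), ‖μ‖ < 1) →
        (∀ i : Fin p, 0 < w₂ i) → (∀ i : Fin p, w₃ i ≠ 0) → (∀ i : Fin p, 0 < w₄ i) →
        MvPolynomial.eval
          (Sum.elim (fun e : {e : Fin p × Fin p // e ∈ E} => A e.1.2 e.1.1)
            (fun ki : Fin 3 × Fin p => ![w₂, w₃, w₄] ki.1 ki.2)) q ≠ 0 →
        Set.Finite {θ' : Matrix (Fin p) (Fin p) ℝ ×
            (Fin p → ℝ) × (Fin p → ℝ) × (Fin p → ℝ) |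
          (∀ i j : Fin p, (i, j) ∉ E → θ'.1 j i = 0) ∧
          (∀ μ ∈ spectrum ℂ (θ'.1.map (algebraMap ℝ ℂ)), ‖μ‖ < 1) ∧
          (∀ i : Fin p, 0 < θ'.2.1 i) ∧ (∀ i : Fin p, θ'.2.2.1 i ≠ 0) ∧
          (∀ i : Fin p, 0 < θ'.2.2.2 i) ∧
          steadyCumulant p 2 θ'.1 θ'.2.1 = steadyCumulant p 2 A w₂ ∧
          steadyCumulant p 3 θ'.1 θ'.2.2.1 = steadyCumulant p 3 A w₃ ∧
          steadyCumulant p 4 θ'.1 θ'.2.2.2 = steadyCumulant p 4 A w₄} := by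
  classical
  choose G num hnum hG using fun x => elim_exists hp E hself hnoiso x
  refine ⟨∏ x, num x, Finset.prod_ne_zero_iff.mpr fun x _ => hnum x, ?_⟩
  intro A w₂ w₃ w₄ hA hst _ _ _ hq
  have hq' : ∀ x, MvPolynomial.eval (pt E A ![w₂, w₃, w₄]) (num x) ≠ 0 := by
    intro x hx
    apply hq
    rw [map_prod]
    exact Finset.prod_eq_zero (Finset.mem_univ x) hx
  refine Set.Finite.of_injOn
    (f := fun θ' => pt E θ'.1 ![θ'.2.1, θ'.2.2.1, θ'.2.2.2])
    (t := Set.pi Set.univ fun x =>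
      {y : ℝ | ((G x).map (MvPolynomial.eval (cum A ![w₂, w₃, w₄]))).eval y = 0}) ?_ ?_
    (Set.Finite.pi fun x => ?_)
  · rintro ⟨A', u₂, u₃, u₄⟩ ⟨h1, h2, _, _, _, e2, e3, e4⟩ x _
    have hc : cum A' ![u₂, u₃, u₄] = cum A ![w₂, w₃, w₄] := by
      funext ⟨k, i⟩
      fin_cases k
      · exact congrFun e2 i
      · exact congrFun e3 i
      · exact congrFun e4 i
    have := (hG x A' ![u₂, u₃, u₄] h1 h2).2
    rw [hc] at this
    exact this
  · rintro ⟨A', u₂, u₃, u₄⟩ ⟨h1, _⟩ ⟨B', v₂, v₃, v₄⟩ ⟨h1', _⟩ h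
    have hc : ∀ x, pt E A' ![u₂, u₃, u₄] x = pt E B' ![v₂, v₃, v₄] x := fun x => congrFun h x
    have hAB : A' = B' := by
      ext j i
      by_cases hE : (i, j) ∈ E
      · exact hc (Sum.inl ⟨(i, j), hE⟩)
      · exact (h1 i j hE).trans (h1' i j hE).symm
    have h2 : u₂ = v₂ := funext fun i => hc (Sum.inr (0, i))
    have h3 : u₃ = v₃ := funext fun i => hc (Sum.inr (1, i))
    have h4 : u₄ = v₄ := funext fun i => hc (Sum.inr (2, i))
    rw [hAB, h2, h3, h4]
  · have h0 := (hG x A ![w₂, w₃, w₄] hA hst).1 (hq' x)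
    exact Polynomial.finite_setOf_isRoot h0
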